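/- arXiv:1007.0279 — 3 statements merged into one kernel-verified Lean document; each statement's English description precedes it below -/
import Mathlib

section
/- Let σ be an integer greater than 1, α and β integers not congruent to 0 modulo σ, ω a primitive σ-th root of unity in ℂ, F a finite field with q = |F| elements, E a finite set, and G a matrix over F with columns indexed by E, of rank r. For k = 0, 1, …, σ−1, let ℳ_{α,β}(k,σ) be the set of pairs (f, g) of functions f, g : E → F such that f − g is a flow of G and α|supp(f)| + β|supp(g)| ≡ k mod σ. If ω^α + ω^β + (q−2)ω^{α+β} ≠ 0, then Σ_{k=0}^{σ−1} ω^k |ℳ_{α,β}(k,σ)| = (1 − ω^α)^r (1 − ω^β)^r [ω^α + ω^β + (q−2)ω^{α+β}]^{|E|−r} · R(M(G); q[ω^α + ω^β + (q−2)ω^{α+β}]/((1 − ω^α)(1 − ω^β)), (1 − ω^α)(1 − ω^β)/(ω^α + ω^β + (q−2)ω^{α+β})). -/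
open Finset

/-- The subspace of the row space of `G` vanishing on the coordinates in `B` has dimension equal to
the rank of `G` minus the rank of the columns of `G` indexed by `B`. -/
theorem finrank_rowSpace_vanishing_add_finrank_cols {F κ ι : Type*} [Field F] [Fintype κ]
    [Fintype ι] (G : κ → ι → F) (B : Finset ι) :
    Module.finrank F (LinearMap.ker ((LinearMap.funLeft F F ((↑) : B → ι)).domRestrict
        (Submodule.span F (Set.range G)))) +
      Module.finrank F (Submodule.span F ((fun e i => G i e) '' (B : Set ι))) =
    Module.finrank F (Submodule.span F (Set.range G)) := by
  rw [← LinearMap.finrank_range_add_finrank_ker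
    ((LinearMap.funLeft F F ((↑) : B → ι)).domRestrict (Submodule.span F (Set.range G))), add_comm]
  congr 1
  rw [LinearMap.range_domRestrict, Submodule.map_span, ← Set.range_comp]
  have hrow := Matrix.rank_eq_finrank_span_row (Matrix.of fun i (e : B) => G i e)
  have hcol := Matrix.rank_eq_finrank_span_cols (Matrix.of fun i (e : B) => G i e)
  have himage : (fun e i => G i e) '' (B : Set ι) =
      Set.range (Matrix.of fun i (e : B) => G i e).col := by
    ext v
    simp [Matrix.col_def, funext_iff]
  rw [himage, ← hcol, hrow]
  rfl

theorem finrank_span_rows_eq_finrank_span_cols {F κ ι : Type*} [Field F] [Fintype κ]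
    [Fintype ι] (G : κ → ι → F) :
    Module.finrank F (Submodule.span F (Set.range G)) =
      Module.finrank F (Submodule.span F (Set.range fun e i => G i e)) :=
  (Matrix.rank_eq_finrank_span_row (Matrix.of G)).symm.trans
    (Matrix.rank_eq_finrank_span_cols (Matrix.of G))

/-- The number of vectors in the row space of `G` vanishing on `B`. -/
theorem card_rowSpace_vanishing {F κ ι : Type*} [Field F] [Fintype F] [Fintype κ] [Fintype ι]
    [DecidableEq F] [DecidableEq ι] (G : κ → ι → F) (B : Finset ι)
    (P : (ι → F) → Prop) [DecidablePred P] (hP : ∀ h, P h ↔ h ∈ Submodule.span F (Set.range G)) :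
    (univ.filter fun h : ι → F => P h ∧ ∀ e ∈ B, h e = 0).card = Fintype.card F ^
      (Module.finrank F (Submodule.span F (Set.range G)) -
        Module.finrank F (Submodule.span F ((fun e i => G i e) '' (B : Set ι)))) := by
  classical
  rw [← finrank_rowSpace_vanishing_add_finrank_cols G B, Nat.add_sub_cancel,
    ← Nat.card_eq_fintype_card, ← Module.natCard_eq_pow_finrank (K := F) (V := LinearMap.ker
      ((LinearMap.funLeft F F ((↑) : B → ι)).domRestrict (Submodule.span F (Set.range G)))), ← Fintype.card_subtype,
    ← Nat.card_eq_fintype_card]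
  refine Nat.card_congr
    { toFun := fun h => ⟨⟨h.1, (hP _).1 h.2.1⟩, ?_⟩
      invFun := fun h => ⟨h.1.1, (hP _).2 h.1.2, fun e he => ?_⟩
      left_inv := fun _ => rfl
      right_inv := fun _ => rfl }
  · rw [LinearMap.mem_ker]
    ext e
    exact h.2.2 e e.2
  · exact congrFun (LinearMap.mem_ker.1 h.2) ⟨e, he⟩

/-- The convolution of two weights on `F`, each depending only on whether its argument vanishes. -/
theorem sum_ite_mul_ite {F : Type*} [Field F] [Fintype F] [DecidableEq F] (a b : ℂ) (x : F) :
    ∑ y : F, (if x + y ≠ 0 then a else 1) * (if y ≠ 0 then b else 1) =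
      (if x = 0 then (1 - a) * (1 - b) else 0) +
        (a + b + ((Fintype.card F : ℂ) - 2) * (a * b)) := by
  have h (y : F) : (if x + y ≠ 0 then a else 1) * (if y ≠ 0 then b else 1) =
      a * b + (if y = -x then (1 - a) * b else 0) +
        (if y = 0 then a * (1 - b) + (if x = 0 then (1 - a) * (1 - b) else 0) else 0) := by
    have hxy : x + y = 0 ↔ y = -x := by rw [add_comm, add_eq_zero_iff_eq_neg]
    by_cases hy : y = 0
    · subst hy
      by_cases hx : x = 0
      · simp [hx]; ring
      · simp [hx, Ne.symm (neg_ne_zero.2 hx)]; ring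
    · by_cases hx : y = -x
      · simp [hx, show x ≠ 0 by rintro rfl; simp_all]; ring
      · simp [hy, hxy, hx]
  simp_rw [h, sum_add_distrib, sum_ite_eq' univ, mem_univ, if_true, sum_const, card_univ,
    nsmul_eq_mul]
  ring

theorem prod_ite_eq_pow_card {F ι R : Type*} [Field F] [Fintype ι] [DecidableEq F]
    [CommMonoid R] (a : R) (f : ι → F) :
    ∏ e, (if f e ≠ 0 then a else 1) = a ^ (univ.filter fun e => f e ≠ 0).card := by
  rw [prod_ite, prod_const_one, mul_one, prod_const]

/-- The support enumerator of pairs with difference in `P`, as a sum over the set of coordinates on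
which the difference is required to vanish. -/
theorem sum_pow_supp_mul_pow_supp {F ι : Type*} [Field F] [Fintype F] [DecidableEq F] [Fintype ι]
    [DecidableEq ι] (P : (ι → F) → Prop) [DecidablePred P] (a b : ℂ) :
    ∑ p : (ι → F) × (ι → F) with P (p.1 - p.2),
        a ^ (univ.filter fun e => p.1 e ≠ 0).card * b ^ (univ.filter fun e => p.2 e ≠ 0).card =
      ∑ B : Finset ι, ((univ.filter fun h : ι → F => P h ∧ ∀ e ∈ B, h e = 0).card : ℂ) *
        (((1 - a) * (1 - b)) ^ B.card *
          (a + b + ((Fintype.card F : ℂ) - 2) * (a * b)) ^ (Fintype.card ι - B.card)) := by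
  set N := (1 - a) * (1 - b) with hN
  set D := a + b + ((Fintype.card F : ℂ) - 2) * (a * b) with hD
  have hfiber (h : ι → F) :
      ∑ g : ι → F, a ^ (univ.filter fun e => (h + g) e ≠ 0).card *
          b ^ (univ.filter fun e => g e ≠ 0).card =
        ∑ B : Finset ι, if ∀ e ∈ B, h e = 0 then N ^ B.card * D ^ (Fintype.card ι - B.card)
          else 0 := by
    simp_rw [← prod_ite_eq_pow_card, ← prod_mul_distrib, Pi.add_apply]
    rw [← Fintype.prod_sum (fun e y => (if h e + y ≠ 0 then a else 1) * (if y ≠ 0 then b else 1))]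
    simp_rw [sum_ite_mul_ite, ← hN, ← hD]
    rw [Fintype.prod_add]
    refine sum_congr rfl fun B _ => ?_
    rw [prod_const, card_compl, prod_ite_zero, prod_const]
    split_ifs <;> simp
  have hshift : ∑ p : (ι → F) × (ι → F) with P (p.1 - p.2),
        a ^ (univ.filter fun e => p.1 e ≠ 0).card * b ^ (univ.filter fun e => p.2 e ≠ 0).card =
      ∑ h : ι → F with P h, ∑ g : ι → F, a ^ (univ.filter fun e => (h + g) e ≠ 0).card *
          b ^ (univ.filter fun e => g e ≠ 0).card := by
    rw [← sum_product' (univ.filter P) univ (fun h g : ι → F =>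
      a ^ (univ.filter fun e => (h + g) e ≠ 0).card * b ^ (univ.filter fun e => g e ≠ 0).card)]
    refine sum_bij' (fun p _ => (p.1 - p.2, p.2)) (fun p _ => (p.1 + p.2, p.2)) ?_ ?_ ?_ ?_ ?_ <;>
      simp
  rw [hshift]
  simp_rw [hfiber]
  rw [sum_comm]
  refine sum_congr rfl fun B _ => ?_
  rw [← sum_filter, sum_const, nsmul_eq_mul, filter_filter]

/-- Grouping a sum of integer powers of a `σ`-th root of unity by residues of the exponents. -/
theorem sum_range_pow_mul_card_emod {τ : Type*} (s : Finset τ) (m : τ → ℤ) {σ : ℕ} (hσ : 0 < σ)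
    {ω : ℂ} (hω : ω ^ σ = 1) :
    ∑ k ∈ range σ, ω ^ k * ((s.filter fun p => m p % (σ : ℤ) = (k : ℤ)).card : ℂ) =
      ∑ p ∈ s, ω ^ m p := by
  have hω0 : ω ≠ 0 := by rintro rfl; simp [hσ.ne'] at hω
  simp_rw [card_filter, Nat.cast_sum, mul_sum]
  rw [sum_comm]
  refine sum_congr rfl fun p _ => ?_
  have h0 : 0 ≤ m p % (σ : ℤ) := Int.emod_nonneg _ (by omega)
  have h1 : m p % (σ : ℤ) < σ := Int.emod_lt_of_pos _ (by omega)
  obtain ⟨k, hk⟩ := Int.eq_ofNat_of_zero_le h0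
  have hpow : ω ^ m p = ω ^ k := by
    rw [← Int.emod_add_mul_ediv (m p) σ, zpow_add₀ hω0, zpow_mul, hk, zpow_natCast, zpow_natCast,
      hω, one_zpow, mul_one]
  rw [hk, hpow, sum_eq_single k]
  · simp
  · intro j _ hj
    simp [Ne.symm hj]
  · intro h
    rw [mem_range] at h
    omega

theorem zpow_ne_one_of_not_dvd {ω : ℂ} {σ : ℕ} (hσ : 0 < σ) (hω : ω ^ σ = 1)
    (hprim : ∀ j : ℕ, 0 < j → j < σ → ω ^ j ≠ 1) {m : ℤ} (hm : ¬ (σ : ℤ) ∣ m) : ω ^ m ≠ 1 :=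
  fun h => hm (((IsPrimitiveRoot.mk_of_lt ω hσ hω hprim).zpow_eq_one_iff_dvd m).1 h)

/-- Clearing denominators in a term of the rank generating polynomial. -/
theorem pow_mul_rank_term {N D q : ℂ} (hN : N ≠ 0) (hD : D ≠ 0) {r k c E : ℕ}
    (hkr : k ≤ r) (hkc : k ≤ c) (hrE : r ≤ E) (hcE : c ≤ E) :
    N ^ r * D ^ (E - r) * ((q * D / N) ^ (r - k) * (N / D) ^ (c - k)) =
      q ^ (r - k) * (N ^ c * D ^ (E - c)) := by
  obtain ⟨i, rfl⟩ := Nat.exists_eq_add_of_le hkr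
  obtain ⟨j, rfl⟩ := Nat.exists_eq_add_of_le hkc
  obtain ⟨t, rfl⟩ := Nat.exists_eq_add_of_le hrE
  obtain ⟨u, hu⟩ := Nat.exists_eq_add_of_le hcE
  have e1 : k + i + t - (k + j) = u := by omega
  have e2 : i + t = j + u := by omega
  have e3 : D ^ i * D ^ t = D ^ j * D ^ u := by rw [← pow_add, ← pow_add, e2]
  simp only [e1, Nat.add_sub_cancel_left, div_pow, mul_pow, pow_add]
  field_simp
  linear_combination q ^ i * e3

/-- **Theorem 4.1.** Parcels defined by `α|supp(f)| + β|supp(g)| ≡ k mod σ`. -/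
theorem stmt_6
    {F : Type*} [Field F] [Fintype F] [DecidableEq F]
    {ι : Type*} [Fintype ι] [DecidableEq ι]
    {n : ℕ} (G : Fin n → ι → F)
    (q : ℕ) (hq : q = Fintype.card F)
    (rk : Finset ι → ℕ)
    (hrk : ∀ B : Finset ι,
      rk B = Module.finrank F (Submodule.span F ((fun e => fun i => G i e) '' (B : Set ι))))
    (r : ℕ) (hr : r = rk Finset.univ)
    (Flow : (ι → F) → Prop) [DecidablePred Flow]
    (hFlow : ∀ h : ι → F, Flow h ↔ h ∈ Submodule.span F (Set.range G))
    (σ : ℕ) (hσ : 1 < σ)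
    (α β : ℤ) (hα : ¬ ((σ : ℤ) ∣ α)) (hβ : ¬ ((σ : ℤ) ∣ β))
    (ω : ℂ) (hω : ω ^ σ = 1) (hωprim : ∀ j : ℕ, 0 < j → j < σ → ω ^ j ≠ 1)
    (hden : ω ^ α + ω ^ β + ((q : ℂ) - 2) * ω ^ (α + β) ≠ 0) :
    ∑ k ∈ Finset.range σ, ω ^ k *
        ((Finset.univ.filter (fun p : (ι → F) × (ι → F) =>
          Flow (p.1 - p.2) ∧
            (α * ((Finset.univ.filter (fun e => p.1 e ≠ 0)).card : ℤ)
              + β * ((Finset.univ.filter (fun e => p.2 e ≠ 0)).card : ℤ)) % (σ : ℤ)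
              = (k : ℤ))).card : ℂ)
      = (1 - ω ^ α) ^ r * (1 - ω ^ β) ^ r *
          (ω ^ α + ω ^ β + ((q : ℂ) - 2) * ω ^ (α + β)) ^ (Fintype.card ι - r) *
          ∑ B : Finset ι,
            ((q : ℂ) * (ω ^ α + ω ^ β + ((q : ℂ) - 2) * ω ^ (α + β))
                / ((1 - ω ^ α) * (1 - ω ^ β))) ^ (r - rk B) *
              ((1 - ω ^ α) * (1 - ω ^ β)
                / (ω ^ α + ω ^ β + ((q : ℂ) - 2) * ω ^ (α + β))) ^ (B.card - rk B) := by
  subst hq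
  have hσ0 : 0 < σ := by omega
  have hω0 : ω ≠ 0 := by rintro rfl; simp [hσ0.ne'] at hω
  have ha := zpow_ne_one_of_not_dvd hσ0 hω hωprim hα
  have hb := zpow_ne_one_of_not_dvd hσ0 hω hωprim hβ
  have hN : (1 - ω ^ α) * (1 - ω ^ β) ≠ 0 :=
    mul_ne_zero (sub_ne_zero.2 ha.symm) (sub_ne_zero.2 hb.symm)
  have hrow : Module.finrank F (Submodule.span F (Set.range G)) = r := by
    rw [hr, hrk, finrank_span_rows_eq_finrank_span_cols, coe_univ, Set.image_univ]
  have hle_r (B : Finset ι) : rk B ≤ r := by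
    rw [hr, hrk, hrk]
    exact Submodule.finrank_mono (Submodule.span_mono (Set.image_mono (by simp)))
  have hle_card (B : Finset ι) : rk B ≤ B.card := by
    classical
    rw [hrk, ← coe_image]
    exact (finrank_span_finset_le_card _).trans card_image_le
  have hrE : r ≤ Fintype.card ι := hr ▸ hle_card univ
  simp_rw [← filter_filter]
  rw [sum_range_pow_mul_card_emod _ _ hσ0 hω]
  simp_rw [zpow_add₀ hω0, zpow_mul, zpow_natCast]
  rw [sum_pow_supp_mul_pow_supp, ← mul_pow, mul_sum]
  refine sum_congr rfl fun B _ => ?_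
  rw [zpow_add₀ hω0] at hden
  rw [pow_mul_rank_term hN hden (hle_r B) (hle_card B) hrE (card_le_univ B),
    card_rowSpace_vanishing G B Flow hFlow, hrow, ← hrk B, Nat.cast_pow]
end

section
/- Let σ be an integer greater than 1, ω a primitive σ-th root of unity in ℂ, F a finite field with q = |F| elements, E a finite set, and G a matrix over F with columns indexed by E, of rank r. For k = 0, 1, …, σ−1, let ℳ_{1,1}(k,σ) be the set of pairs (f, g) of functions f, g : E → F such that f − g is a flow of G and |supp(f)| + |supp(g)| ≡ k mod σ. Then, except in the case σ = 2 and q = 4, Σ_{k=0}^{σ−1} ω^k |ℳ_{1,1}(k,σ)| = (1 − ω)^{2r} (2ω + ω²(q−2))^{|E|−r} R(M(G); q(2ω + ω²(q−2))/(1 − ω)², (1 − ω)²/(2ω + ω²(q−2))). Moreover, in the exceptional case σ = 2, q = 4 (so ω = −1), |ℳ_{1,1}(0,2)| − |ℳ_{1,1}(1,2)| = 4^{|E|}. -/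
open Finset

/-- The flows vanishing on `B` are the kernel of the restriction to `B` of the row space. -/
lemma card_rowSpan_vanishing_on {F ι : Type*} [Field F] [Fintype F] [Fintype ι] [DecidableEq ι]
    {n : ℕ} (G : Fin n → ι → F) (rk : Finset ι → ℕ)
    (hrk : ∀ B : Finset ι,
      rk B = Module.finrank F (Submodule.span F ((fun e => fun i => G i e) '' (B : Set ι))))
    (B : Finset ι) :
    Nat.card {h : ι → F // h ∈ Submodule.span F (Set.range G) ∧ ∀ e ∈ B, h e = 0}
      = Fintype.card F ^ (rk Finset.univ - rk B) := by
  set W := Submodule.span F (Set.range G)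
  let φ : W →ₗ[F] (B → F) := (LinearMap.funLeft F F Subtype.val).domRestrict W
  have hcols : rk B = ((Matrix.of G).submatrix id (Subtype.val : B → ι)).rank := by
    rw [hrk, Matrix.rank_eq_finrank_span_cols, Set.image_eq_range]
    rfl
  have hrow : rk Finset.univ = Module.finrank F W := by
    have h : rk Finset.univ = (Matrix.of G).rank := by
      rw [hrk, Matrix.rank_eq_finrank_span_cols, Finset.coe_univ, Set.image_univ]
      rfl
    rw [h, Matrix.rank_eq_finrank_span_row]
    rfl
  have himage : rk B = Module.finrank F (LinearMap.range φ) := by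
    rw [hcols, Matrix.rank_eq_finrank_span_row, LinearMap.range_domRestrict,
      Submodule.map_span, ← Set.range_comp]
    rfl
  have hker : Module.finrank F (LinearMap.ker φ) = rk Finset.univ - rk B := by
    have := φ.finrank_range_add_finrank_ker
    omega
  have e : {h : ι → F // h ∈ W ∧ ∀ e ∈ B, h e = 0} ≃ LinearMap.ker φ :=
    { toFun := fun h => ⟨⟨h.1, h.2.1⟩, by
        rw [LinearMap.mem_ker]
        ext x
        exact h.2.2 x.1 x.2⟩
      invFun := fun h => ⟨h.1.1, h.1.2, fun x hx =>
        congrFun (LinearMap.mem_ker.1 h.2) ⟨x, hx⟩⟩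
      left_inv := fun _ => rfl
      right_inv := fun _ => rfl }
  rw [Nat.card_congr e, Module.natCard_eq_pow_finrank (K := F), hker, Nat.card_eq_fintype_card]

/-- The total weight `a ^ (|supp f| + |supp g|)` of the pairs `(f, g)` of one-coordinate functions
with `f - g = c`. -/
lemma sum_weight_add_mul_weight {F R : Type*} [Field F] [Fintype F] [DecidableEq F] [CommRing R]
    (a : R) (c : F) :
    ∑ x : F, (if c + x ≠ 0 then a else 1) * (if x ≠ 0 then a else 1)
      = (if c = 0 then (1 - a) ^ 2 else 0) + (2 * a + a ^ 2 * ((Fintype.card F : R) - 2)) := by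
  have hsplit (x : F) : (if c + x ≠ 0 then a else 1) * (if x ≠ 0 then a else 1)
      = a ^ 2 + (if x = -c then a * (1 - a) else 0) + (if x = 0 then a * (1 - a) else 0)
        + (if x = 0 then (if c = 0 then (1 - a) ^ 2 else 0) else 0) := by
    by_cases hx : x = 0
    · subst hx
      by_cases hc : c = 0
      · simp [hc]; ring
      · have : (0 : F) ≠ -c := fun h => hc (by simpa using h.symm)
        simp [hc, this]; ring
    · by_cases hxc : x = -c
      · simp [hxc] at hx ⊢
        simp [hx]; ring
      · have : c + x ≠ 0 := fun h => hxc (by linear_combination h)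
        simp [hx, hxc, this]; ring
  simp only [hsplit, Finset.sum_add_distrib, Finset.sum_ite_eq', Finset.mem_univ, if_true,
    Finset.sum_const, Finset.card_univ, nsmul_eq_mul]
  ring

/-- The generating function of the pairs `(f, g)` with `f - g` a flow, by total support size. -/
lemma sum_pow_card_support_add_card_support {F ι R : Type*} [Field F] [Fintype F] [DecidableEq F]
    [Fintype ι] [DecidableEq ι] [CommRing R] {n : ℕ} (G : Fin n → ι → F) (rk : Finset ι → ℕ)
    (hrk : ∀ B : Finset ι,
      rk B = Module.finrank F (Submodule.span F ((fun e => fun i => G i e) '' (B : Set ι))))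
    (Flow : (ι → F) → Prop) [DecidablePred Flow]
    (hFlow : ∀ h : ι → F, Flow h ↔ h ∈ Submodule.span F (Set.range G)) (a : R) :
    ∑ p : (ι → F) × (ι → F) with Flow (p.1 - p.2),
        a ^ (#{e | p.1 e ≠ 0} + #{e | p.2 e ≠ 0})
      = ∑ B : Finset ι, ((1 - a) ^ 2) ^ #B
          * (2 * a + a ^ 2 * ((Fintype.card F : R) - 2)) ^ (Fintype.card ι - #B)
          * (Fintype.card F : R) ^ (rk Finset.univ - rk B) := by
  set y := 2 * a + a ^ 2 * ((Fintype.card F : R) - 2)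
  set z := (1 - a) ^ 2
  have hpow (f : ι → F) : a ^ #{e | f e ≠ 0} = ∏ e, if f e ≠ 0 then a else 1 := by
    rw [Finset.prod_ite]; simp
  have hfiber (h : ι → F) :
      ∑ g : ι → F, a ^ (#{e | (h + g) e ≠ 0} + #{e | g e ≠ 0})
        = ∑ B : Finset ι, if ∀ e ∈ B, h e = 0 then z ^ #B * y ^ (Fintype.card ι - #B) else 0 := by
    simp_rw [pow_add, hpow, ← Finset.prod_mul_distrib, Pi.add_apply]
    rw [← Fintype.prod_sum
      (fun e x => (if h e + x ≠ 0 then a else 1) * (if x ≠ 0 then a else 1))]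
    simp_rw [sum_weight_add_mul_weight]
    rw [Finset.prod_add, Finset.powerset_univ]
    refine Finset.sum_congr rfl fun B _ => ?_
    rw [Finset.prod_const, Finset.card_sdiff_of_subset (Finset.subset_univ B), Finset.card_univ]
    split_ifs with hB
    · rw [Finset.prod_congr rfl fun e he => if_pos (hB e he), Finset.prod_const]
    · push Not at hB
      obtain ⟨e, he, hne⟩ := hB
      rw [Finset.prod_eq_zero he (if_neg hne), zero_mul]
  have hshift : ∑ p : (ι → F) × (ι → F) with Flow (p.1 - p.2),
        a ^ (#{e | p.1 e ≠ 0} + #{e | p.2 e ≠ 0})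
      = ∑ h with Flow h, ∑ g : ι → F, a ^ (#{e | (h + g) e ≠ 0} + #{e | g e ≠ 0}) := by
    rw [← Finset.sum_product']
    refine Finset.sum_nbij' (fun p => (p.1 - p.2, p.2)) (fun p => (p.1 + p.2, p.2)) ?_ ?_ ?_ ?_ ?_
      <;> simp
  rw [hshift]
  simp_rw [hfiber]
  rw [Finset.sum_comm]
  refine Finset.sum_congr rfl fun B _ => ?_
  rw [← Finset.sum_filter, Finset.sum_const, Finset.filter_filter, nsmul_eq_mul, mul_comm]
  congr 1
  rw [← Nat.cast_pow, ← card_rowSpan_vanishing_on G rk hrk B, ← Nat.subtype_card]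
  simp [hFlow]

/-- Collecting the exponents of powers of a root of unity by residue class. -/
lemma sum_range_pow_mul_card_mod {α R : Type*} [CommSemiring R] {m : ℕ} (hm : 0 < m) {a : R}
    (ha : a ^ m = 1) (s : Finset α) (f : α → ℕ) :
    ∑ k ∈ Finset.range m, a ^ k * (#{x ∈ s | f x % m = k} : R) = ∑ x ∈ s, a ^ f x := by
  rw [← Finset.sum_fiberwise_of_maps_to (t := Finset.range m) (g := fun x => f x % m)
    (fun x _ => Finset.mem_range.2 (Nat.mod_lt _ hm))]
  refine Finset.sum_congr rfl fun k _ => ?_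
  rw [mul_comm, ← nsmul_eq_mul]
  refine (Finset.sum_eq_card_nsmul fun x hx => ?_).symm
  rw [pow_eq_pow_mod _ ha, (Finset.mem_filter.1 hx).2]

/-- A root of unity `w` can only make `2 * w + w ^ 2 * (q - 2)` vanish when `q = 4`, `w = -1`. -/
lemma eq_four_and_eq_neg_one_of_weight_eq_zero {q : ℕ} (hq : 2 ≤ q) {w : ℂ} (hw : ‖w‖ = 1)
    (h : 2 * w + w ^ 2 * ((q : ℂ) - 2) = 0) : q = 4 ∧ w = -1 := by
  have hw0 : w ≠ 0 := by
    rintro rfl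
    simp at hw
  obtain ⟨m, rfl⟩ := Nat.exists_eq_add_of_le hq
  have h2 : w * (m : ℂ) = -2 := by
    push_cast at h
    refine mul_left_cancel₀ hw0 ?_
    linear_combination h
  have hm : m = 2 := by
    have := congrArg norm h2
    rw [norm_mul, hw, one_mul, norm_neg, Complex.norm_natCast, Complex.norm_ofNat] at this
    exact_mod_cast this
  subst hm
  refine ⟨rfl, ?_⟩
  push_cast at h2
  linear_combination h2 / 2

/-- **Theorem 4.2** (with the exceptional case `σ = 2`, `q = 4`).
Parcels defined by `|supp(f)| + |supp(g)| ≡ k mod σ`. -/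
theorem stmt_7
    {F : Type*} [Field F] [Fintype F] [DecidableEq F]
    {ι : Type*} [Fintype ι] [DecidableEq ι]
    {n : ℕ} (G : Fin n → ι → F)
    (q : ℕ) (hq : q = Fintype.card F)
    (rk : Finset ι → ℕ)
    (hrk : ∀ B : Finset ι,
      rk B = Module.finrank F (Submodule.span F ((fun e => fun i => G i e) '' (B : Set ι))))
    (r : ℕ) (hr : r = rk Finset.univ)
    (Flow : (ι → F) → Prop) [DecidablePred Flow]
    (hFlow : ∀ h : ι → F, Flow h ↔ h ∈ Submodule.span F (Set.range G))
    (σ : ℕ) (hσ : 1 < σ)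
    (ω : ℂ) (hω : ω ^ σ = 1) (hωprim : ∀ j : ℕ, 0 < j → j < σ → ω ^ j ≠ 1) :
    (¬ (σ = 2 ∧ q = 4) →
      ∑ k ∈ Finset.range σ, ω ^ k *
          ((Finset.univ.filter (fun p : (ι → F) × (ι → F) =>
            Flow (p.1 - p.2) ∧
              ((Finset.univ.filter (fun e => p.1 e ≠ 0)).card
                + (Finset.univ.filter (fun e => p.2 e ≠ 0)).card) % σ = k)).card : ℂ)
        = (1 - ω) ^ (2 * r) * (2 * ω + ω ^ 2 * ((q : ℂ) - 2)) ^ (Fintype.card ι - r) *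
            ∑ B : Finset ι,
              ((q : ℂ) * (2 * ω + ω ^ 2 * ((q : ℂ) - 2)) / (1 - ω) ^ 2) ^ (r - rk B) *
                ((1 - ω) ^ 2 / (2 * ω + ω ^ 2 * ((q : ℂ) - 2))) ^ (B.card - rk B)) ∧
    (σ = 2 → q = 4 →
      ((Finset.univ.filter (fun p : (ι → F) × (ι → F) =>
          Flow (p.1 - p.2) ∧
            ((Finset.univ.filter (fun e => p.1 e ≠ 0)).card
              + (Finset.univ.filter (fun e => p.2 e ≠ 0)).card) % 2 = 0)).card : ℤ)
        - ((Finset.univ.filter (fun p : (ι → F) × (ι → F) =>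
          Flow (p.1 - p.2) ∧
            ((Finset.univ.filter (fun e => p.1 e ≠ 0)).card
              + (Finset.univ.filter (fun e => p.2 e ≠ 0)).card) % 2 = 1)).card : ℤ)
        = 4 ^ (Fintype.card ι)) := by
  have hrkle (B : Finset ι) : rk B ≤ #B := by
    rw [hrk, ← Finset.coe_image]
    exact (finrank_span_finset_le_card _).trans Finset.card_image_le
  have hrkr (B : Finset ι) : rk B ≤ r := by
    rw [hr, hrk, hrk]
    exact Submodule.finrank_mono (Submodule.span_mono (Set.image_mono (by simp)))
  have hrι : r ≤ Fintype.card ι := hr ▸ hrkle Finset.univ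
  subst hq
  refine ⟨fun hexc => ?_, fun _ h4 => ?_⟩
  · simp_rw [← Finset.filter_filter]
    rw [sum_range_pow_mul_card_mod (by omega) hω,
      sum_pow_card_support_add_card_support G rk hrk Flow hFlow, ← hr]
    have hz : 1 - ω ≠ 0 := fun h => hωprim 1 one_pos hσ (by linear_combination -h)
    have hy : 2 * ω + ω ^ 2 * ((Fintype.card F : ℂ) - 2) ≠ 0 := by
      intro h
      obtain ⟨h4, h1⟩ := eq_four_and_eq_neg_one_of_weight_eq_zero Fintype.one_lt_card
        (Complex.norm_eq_one_of_pow_eq_one hω (by omega)) h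
      refine hexc ⟨?_, h4⟩
      by_contra hne
      exact hωprim 2 two_pos (by omega) (by rw [h1]; norm_num)
    generalize 2 * ω + ω ^ 2 * ((Fintype.card F : ℂ) - 2) = y at hy
    rw [Finset.mul_sum]
    refine Finset.sum_congr rfl fun B _ => ?_
    obtain ⟨s, hs⟩ := Nat.exists_eq_add_of_le (hrkr B)
    obtain ⟨t, ht⟩ := Nat.exists_eq_add_of_le (hrkle B)
    obtain ⟨u, hu⟩ := Nat.exists_eq_add_of_le hrι
    obtain ⟨v, hv⟩ := Nat.exists_eq_add_of_le (Finset.card_le_univ B)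
    have huv : s + u = t + v := by omega
    have hyv : y ^ s * y ^ u = y ^ t * y ^ v := by rw [← pow_add, ← pow_add, huv]
    rw [hv, Nat.add_sub_cancel_left, ← hv, hu, Nat.add_sub_cancel_left, ht,
      Nat.add_sub_cancel_left, hs, Nat.add_sub_cancel_left, pow_mul]
    have hz2 : (1 - ω) ^ 2 ≠ 0 := pow_ne_zero 2 hz
    generalize (1 - ω) ^ 2 = z at hz2
    rw [div_pow, div_pow, mul_pow, pow_add, pow_add]
    field_simp
    linear_combination (-1 : ℂ) * hyv
  · have h := sum_pow_card_support_add_card_support G rk hrk Flow hFlow (-1 : ℤ)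
    rw [← sum_range_pow_mul_card_mod two_pos (by norm_num),
      Finset.sum_eq_single_of_mem Finset.univ (Finset.mem_univ _)] at h
    · simpa [show Finset.range 2 = {0, 1} from rfl, Finset.filter_filter, sub_eq_add_neg, h4] using h
    · intro B _ hB
      have : Fintype.card ι - #B ≠ 0 := by
        have := Finset.card_lt_card (Finset.ssubset_univ_iff.2 hB)
        rw [Finset.card_univ] at this
        omega
      simp [h4, this]
end

section
/- Let F be a finite field with q = |F| elements, E a finite set, and G a matrix over F with columns indexed by E, of rank r. For integers σ > 1 and 0 ≤ k ≤ σ−1, let ℋ(k,σ) be the set of flows h of G with |supp(h)| ≡ k mod σ, and for an integer k ≥ 0 let ℋ(k,∞) be the set of flows h of G with |supp(h)| = k. Then: (i) for any primitive σ-th root of unity ω ∈ ℂ, Σ_{k=0}^{σ−1} ω^k |ℋ(k,σ)| = ω^{|E|−r} (1 − ω)^r R(M(G); qω/(1−ω), (1−ω)/ω); and (ii) for every complex number X with X ≠ 0 and X ≠ 1, Σ_{k=0}^{|E|} |ℋ(k,∞)| X^k = X^{|E|−r} (1 − X)^r R(M(G); qX/(1−X), (1−X)/X). -/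
open Finset

/-- Row rank equals column rank, for the columns of `G` indexed by `B`. -/
theorem finrank_map_restrict_span_range {F ι : Type*} [Field F] {n : ℕ} (G : Fin n → ι → F)
    (B : Finset ι) :
    Module.finrank F ((Submodule.span F (Set.range G)).map
        (LinearMap.funLeft F F (Subtype.val : B → ι))) =
      Module.finrank F (Submodule.span F ((fun e => fun i => G i e) '' (B : Set ι))) := by
  have hrow : (Submodule.span F (Set.range G)).map (LinearMap.funLeft F F (Subtype.val : B → ι)) =
      Submodule.span F (Set.range (Matrix.of fun (i : Fin n) (e : B) => G i e).row) := by
    rw [Submodule.map_span, ← Set.range_comp]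
    rfl
  have hcol : (fun e => fun i => G i e) '' (B : Set ι) =
      Set.range (Matrix.of fun (i : Fin n) (e : B) => G i e).col := by
    rw [Set.image_eq_range]
    rfl
  rw [hrow, hcol]
  exact (Matrix.rank_eq_finrank_span_row _).symm.trans (Matrix.rank_eq_finrank_span_cols _)

theorem card_filter_mem_span_forall_eq_zero {F ι : Type*} [Field F] [Fintype F] [DecidableEq F]
    [Fintype ι] [DecidableEq ι] {n : ℕ} (G : Fin n → ι → F) (Flow : (ι → F) → Prop)
    [DecidablePred Flow] (hFlow : ∀ h : ι → F, Flow h ↔ h ∈ Submodule.span F (Set.range G))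
    (B : Finset ι) :
    (univ.filter fun h : ι → F => Flow h ∧ ∀ e ∈ B, h e = 0).card =
      Fintype.card F ^
        (Module.finrank F (Submodule.span F (Set.range G)) -
          Module.finrank F (Submodule.span F ((fun e => fun i => G i e) '' (B : Set ι)))) := by
  classical
  set C := Submodule.span F (Set.range G)
  set f := (LinearMap.funLeft F F (Subtype.val : B → ι)).domRestrict C with hf
  have hrank := f.finrank_range_add_finrank_ker
  rw [hf, LinearMap.range_domRestrict, ← hf, finrank_map_restrict_span_range] at hrank
  rw [← Nat.eq_sub_of_add_eq' hrank, ← Fintype.card_subtype, ← Nat.card_eq_fintype_card,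
    ← Nat.card_eq_fintype_card,
    ← Module.natCard_eq_pow_finrank (K := F) (V := LinearMap.ker f)]
  refine Nat.card_congr
    { toFun := fun h => ⟨⟨h.1, (hFlow _).1 h.2.1⟩, ?_⟩
      invFun := fun h => ⟨h.1.1, (hFlow _).2 h.1.2, ?_⟩
      left_inv := fun _ => rfl
      right_inv := fun _ => rfl }
  · rw [LinearMap.mem_ker]
    funext e
    exact h.2.2 e e.2
  · intro e he
    exact congrFun (LinearMap.mem_ker.1 h.2) ⟨e, he⟩

theorem pow_card_support_eq_sum {F ι R : Type*} [Zero F] [DecidableEq F] [Fintype ι]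
    [DecidableEq ι] [CommRing R] (X : R) (h : ι → F) :
    X ^ (univ.filter fun e => h e ≠ 0).card =
      ∑ B : Finset ι, if ∀ e ∈ B, h e = 0 then
        (1 - X) ^ B.card * X ^ (Fintype.card ι - B.card) else 0 := by
  have h₁ : X ^ (univ.filter fun e => h e ≠ 0).card =
      ∏ e, ((if h e = 0 then 1 - X else 0) + X) := by
    rw [← prod_const, prod_filter]
    refine prod_congr rfl fun e _ => ?_
    split_ifs <;> simp_all
  rw [h₁, prod_add, powerset_univ]
  refine sum_congr rfl fun B _ => ?_
  rw [prod_const, ← compl_eq_univ_sdiff, card_compl]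
  split_ifs with hB
  · rw [prod_congr rfl fun e he => if_pos (hB e he), prod_const]
  · push Not at hB
    obtain ⟨e, he, hne⟩ := hB
    rw [prod_eq_zero he (if_neg hne), zero_mul]

/-- Greene's theorem, with the weight enumerator written as a sum over codewords. -/
theorem sum_pow_card_support_eq {F : Type*} [Field F] [Fintype F] [DecidableEq F]
    {ι : Type*} [Fintype ι] [DecidableEq ι] {n : ℕ} (G : Fin n → ι → F) (rk : Finset ι → ℕ)
    (hrk : ∀ B : Finset ι,
      rk B = Module.finrank F (Submodule.span F ((fun e => fun i => G i e) '' (B : Set ι))))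
    (Flow : (ι → F) → Prop) [DecidablePred Flow]
    (hFlow : ∀ h : ι → F, Flow h ↔ h ∈ Submodule.span F (Set.range G))
    {K : Type*} [Field K] {X : K} (hX₀ : X ≠ 0) (hX₁ : X ≠ 1) :
    ∑ h : ι → F with Flow h, X ^ (univ.filter fun e => h e ≠ 0).card =
      X ^ (Fintype.card ι - rk univ) * (1 - X) ^ rk univ *
        ∑ B : Finset ι, ((Fintype.card F : K) * X / (1 - X)) ^ (rk univ - rk B) *
          ((1 - X) / X) ^ (B.card - rk B) := by
  have hY : 1 - X ≠ 0 := sub_ne_zero.2 hX₁.symm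
  have hmono : ∀ {A B : Finset ι}, A ⊆ B → rk A ≤ rk B := fun {A B} hAB => by
    rw [hrk, hrk]
    exact Submodule.finrank_mono (Submodule.span_mono (Set.image_mono (by exact_mod_cast hAB)))
  have hcard : ∀ B, rk B ≤ B.card := fun B => by
    rw [hrk, ← coe_image]
    exact (finrank_span_finset_le_card _).trans card_image_le
  have hC : Module.finrank F (Submodule.span F (Set.range G)) = rk univ := by
    rw [hrk, coe_univ, Set.image_univ]
    exact (Matrix.rank_eq_finrank_span_row (Matrix.of G)).symm.trans
      (Matrix.rank_eq_finrank_span_cols (Matrix.of G))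
  simp_rw [pow_card_support_eq_sum X]
  rw [sum_comm, mul_sum]
  refine sum_congr rfl fun B _ => ?_
  rw [← sum_filter, filter_filter, sum_const, card_filter_mem_span_forall_eq_zero G Flow hFlow,
    hC, ← hrk B, nsmul_eq_mul]
  obtain ⟨a, ha⟩ := Nat.exists_eq_add_of_le (hmono (subset_univ B))
  obtain ⟨b, hb⟩ := Nat.exists_eq_add_of_le (hcard B)
  obtain ⟨c, hc⟩ := Nat.exists_eq_add_of_le (card_le_univ B)
  obtain ⟨d, hd⟩ := Nat.exists_eq_add_of_le (hcard univ)
  rw [card_univ] at hd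
  have hd' : Fintype.card ι - rk univ = d := by omega
  have hc' : Fintype.card ι - B.card = c := by omega
  have ha' : rk univ - rk B = a := by omega
  have hb' : B.card - rk B = b := by omega
  have hexp : d + a = c + b := by omega
  rw [hd', hc', ha', hb', ha, hb]
  simp only [div_pow, mul_pow, Nat.cast_pow]
  field_simp
  rw [pow_add, pow_add]
  linear_combination (-(Fintype.card F : K) ^ a * (1 - X) ^ (rk B + a + b)) * congrArg (X ^ ·) hexp

/-- **Theorem 7.3 (and Greene's theorem).** Flow-support enumerators:
(i) the congruence version and (ii) the exact (weight-enumerator) version. -/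
theorem stmt_19
    {F : Type*} [Field F] [Fintype F] [DecidableEq F]
    {ι : Type*} [Fintype ι] [DecidableEq ι]
    {n : ℕ} (G : Fin n → ι → F)
    (q : ℕ) (hq : q = Fintype.card F)
    (rk : Finset ι → ℕ)
    (hrk : ∀ B : Finset ι,
      rk B = Module.finrank F (Submodule.span F ((fun e => fun i => G i e) '' (B : Set ι))))
    (r : ℕ) (hr : r = rk Finset.univ)
    (Flow : (ι → F) → Prop) [DecidablePred Flow]
    (hFlow : ∀ h : ι → F, Flow h ↔ h ∈ Submodule.span F (Set.range G)) :
    (∀ (σ : ℕ), 1 < σ → ∀ ω : ℂ, ω ^ σ = 1 → (∀ j : ℕ, 0 < j → j < σ → ω ^ j ≠ 1) →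
      ∑ k ∈ Finset.range σ, ω ^ k *
          ((Finset.univ.filter (fun h : ι → F =>
            Flow h ∧ (Finset.univ.filter (fun e => h e ≠ 0)).card % σ = k)).card : ℂ)
        = ω ^ (Fintype.card ι - r) * (1 - ω) ^ r *
            ∑ B : Finset ι,
              ((q : ℂ) * ω / (1 - ω)) ^ (r - rk B) *
                ((1 - ω) / ω) ^ (B.card - rk B)) ∧
    (∀ X : ℂ, X ≠ 0 → X ≠ 1 →
      ∑ k ∈ Finset.range (Fintype.card ι + 1),
          ((Finset.univ.filter (fun h : ι → F =>
            Flow h ∧ (Finset.univ.filter (fun e => h e ≠ 0)).card = k)).card : ℂ) * X ^ k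
        = X ^ (Fintype.card ι - r) * (1 - X) ^ r *
            ∑ B : Finset ι,
              ((q : ℂ) * X / (1 - X)) ^ (r - rk B) *
                ((1 - X) / X) ^ (B.card - rk B)) := by
  subst hq hr
  refine ⟨fun σ hσ ω hω hprim => ?_, fun X hX₀ hX₁ => ?_⟩
  · have hω₀ : ω ≠ 0 := by
      rintro rfl
      rw [zero_pow (by omega)] at hω
      exact zero_ne_one hω
    have hω₁ : ω ≠ 1 := by simpa using hprim 1 one_pos hσ
    rw [← sum_pow_card_support_eq G rk hrk Flow hFlow hω₀ hω₁,
      ← sum_fiberwise_of_maps_to (t := range σ)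
        (g := fun h : ι → F => (univ.filter fun e => h e ≠ 0).card % σ)
        fun h _ => mem_range.2 (Nat.mod_lt _ (by omega))]
    refine sum_congr rfl fun k _ => ?_
    rw [filter_filter, sum_congr rfl (g := fun _ => ω ^ k), sum_const, nsmul_eq_mul, mul_comm]
    intro h hh
    rw [← (mem_filter.1 hh).2.2]
    exact pow_eq_pow_mod _ hω
  · rw [← sum_pow_card_support_eq G rk hrk Flow hFlow hX₀ hX₁,
      ← sum_fiberwise_of_maps_to (t := range (Fintype.card ι + 1))
        (g := fun h : ι → F => (univ.filter fun e => h e ≠ 0).card)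
        fun h _ => mem_range.2 (Nat.lt_succ_of_le (card_le_univ _))]
    refine sum_congr rfl fun k _ => ?_
    rw [filter_filter, sum_congr rfl (g := fun _ => X ^ k), sum_const, nsmul_eq_mul]
    intro h hh
    rw [← (mem_filter.1 hh).2.2]
end
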